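/- arXiv:2605.31269 — 4 statements merged into one kernel-verified Lean document; each statement's English description precedes it below -/
import Mathlib

section
/- Let φ(z₁,…,zₙ) be a ∀D(τ)-formula of the form ∀y₁…∀y_l β with β ∈ DQF(τ). The following are equivalent: (1) φ is strongly coherent; (2) φ is rewritable to a universal first-order sentence; (3) φ is first-order rewritable. Moreover, if the rewriting sentence is equivalent to a universal first-order sentence with m universal quantifiers, then φ is strongly m^{n+l}-coherent. -/
/-! Core definitions: team semantics for dependence logic over a relational vocabulary. -/

/-- A structure for a relational vocabulary: `σ` is the type of relation symbols,
`ar` gives their arities, `A` is the universe. -/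
structure DepStr (σ : Type) (ar : σ → ℕ) (A : Type) where
  rel : ∀ r : σ, (Fin (ar r) → A) → Prop

/-- Formulas of dependence logic (in negation normal form), with free variables
of type `V`; quantifiers extend the variable type by one fresh variable (`Option`). -/
inductive DepFormula (σ : Type) (ar : σ → ℕ) : Type → Type 1 where
  | rel {V : Type} (r : σ) (ts : Fin (ar r) → V) : DepFormula σ ar V
  | nrel {V : Type} (r : σ) (ts : Fin (ar r) → V) : DepFormula σ ar V
  | eq {V : Type} (x y : V) : DepFormula σ ar V
  | neq {V : Type} (x y : V) : DepFormula σ ar V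
  | dep {V : Type} (m : ℕ) (ys : Fin m → V) (z : V) : DepFormula σ ar V
  | and {V : Type} (φ ψ : DepFormula σ ar V) : DepFormula σ ar V
  | or {V : Type} (φ ψ : DepFormula σ ar V) : DepFormula σ ar V
  | all {V : Type} (φ : DepFormula σ ar (Option V)) : DepFormula σ ar V
  | ex {V : Type} (φ : DepFormula σ ar (Option V)) : DepFormula σ ar V

/-- Team semantics: `DepSat M V φ T` says that the team `T` (a set of assignments
`V → A`) satisfies `φ` in the structure `M`. -/
def DepSat {σ : Type} {ar : σ → ℕ} {A : Type} (M : DepStr σ ar A) :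
    (V : Type) → DepFormula σ ar V → Set (V → A) → Prop
  | _, .rel r ts, T => ∀ s ∈ T, M.rel r fun i => s (ts i)
  | _, .nrel r ts, T => ∀ s ∈ T, ¬ M.rel r fun i => s (ts i)
  | _, .eq x y, T => ∀ s ∈ T, s x = s y
  | _, .neq x y, T => ∀ s ∈ T, s x ≠ s y
  | _, .dep _ ys z, T => ∀ s₁ ∈ T, ∀ s₂ ∈ T, (∀ i, s₁ (ys i) = s₂ (ys i)) → s₁ z = s₂ z
  | V, .and φ ψ, T => DepSat M V φ T ∧ DepSat M V ψ T
  | V, .or φ ψ, T => ∃ T₁ T₂, T = T₁ ∪ T₂ ∧ DepSat M V φ T₁ ∧ DepSat M V ψ T₂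
  | V, .all φ, T => DepSat M (Option V) φ {s | (fun v => s (some v)) ∈ T}
  | V, .ex φ, T => ∃ f : (V → A) → A,
      DepSat M (Option V) φ {s | ∃ t ∈ T, s = fun o => Option.elim o (f t) t}

/-- The `∃`-free (universal) fragment `∀D`. -/
def DepFormula.noEx {σ : Type} {ar : σ → ℕ} : (V : Type) → DepFormula σ ar V → Prop
  | _, .ex _ => False
  | V, .all φ => DepFormula.noEx (Option V) φ
  | V, .and φ ψ => DepFormula.noEx V φ ∧ DepFormula.noEx V ψ
  | V, .or φ ψ => DepFormula.noEx V φ ∧ DepFormula.noEx V ψ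
  | _, _ => True

/-- The quantifier-free fragment `DQF`. -/
def DepFormula.isQF {σ : Type} {ar : σ → ℕ} : (V : Type) → DepFormula σ ar V → Prop
  | _, .ex _ => False
  | _, .all _ => False
  | V, .and φ ψ => DepFormula.isQF V φ ∧ DepFormula.isQF V ψ
  | V, .or φ ψ => DepFormula.isQF V φ ∧ DepFormula.isQF V ψ
  | _, _ => True

/-- The dependence-atom-free (first-order) fragment. -/
def DepFormula.noDep {σ : Type} {ar : σ → ℕ} : (V : Type) → DepFormula σ ar V → Prop
  | _, .dep _ _ _ => False
  | V, .and φ ψ => DepFormula.noDep V φ ∧ DepFormula.noDep V ψ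
  | V, .or φ ψ => DepFormula.noDep V φ ∧ DepFormula.noDep V ψ
  | V, .all φ => DepFormula.noDep (Option V) φ
  | V, .ex φ => DepFormula.noDep (Option V) φ
  | _, _ => True

/-- Induced substructure on a subset `B` of the universe (relational vocabulary). -/
def DepStr.sub {σ : Type} {ar : σ → ℕ} {A : Type} (M : DepStr σ ar A) (B : Set A) :
    DepStr σ ar B :=
  ⟨fun r v => M.rel r fun i => (v i : A)⟩

/-- Restriction `T ↾ B` of a team to assignments taking values in `B`. -/
def teamRestrict {V A : Type} (T : Set (V → A)) (B : Set A) : Set (V → B) :=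
  {t | (fun v => (t v : A)) ∈ T}


/-- First-order formulas over a relational vocabulary. -/
inductive FOForm (σ : Type) (ar : σ → ℕ) : Type → Type 1 where
  | rel {V : Type} (r : σ) (ts : Fin (ar r) → V) : FOForm σ ar V
  | eq {V : Type} (x y : V) : FOForm σ ar V
  | not {V : Type} (φ : FOForm σ ar V) : FOForm σ ar V
  | and {V : Type} (φ ψ : FOForm σ ar V) : FOForm σ ar V
  | or {V : Type} (φ ψ : FOForm σ ar V) : FOForm σ ar V
  | all {V : Type} (φ : FOForm σ ar (Option V)) : FOForm σ ar V
  | ex {V : Type} (φ : FOForm σ ar (Option V)) : FOForm σ ar V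

/-- Tarskian satisfaction of a first-order formula by a single assignment. -/
def FOSat {σ : Type} {ar : σ → ℕ} {A : Type} (M : DepStr σ ar A) :
    (V : Type) → FOForm σ ar V → (V → A) → Prop
  | _, .rel r ts, s => M.rel r fun i => s (ts i)
  | _, .eq x y, s => s x = s y
  | V, .not φ, s => ¬ FOSat M V φ s
  | V, .and φ ψ, s => FOSat M V φ s ∧ FOSat M V ψ s
  | V, .or φ ψ, s => FOSat M V φ s ∨ FOSat M V ψ s
  | V, .all φ, s => ∀ a : A, FOSat M (Option V) φ (fun o => Option.elim o a s)
  | V, .ex φ, s => ∃ a : A, FOSat M (Option V) φ (fun o => Option.elim o a s)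

/-- A first-order sentence (no free variables) is true in `M`. -/
def FOTrue {σ : Type} {ar : σ → ℕ} {A : Type} (M : DepStr σ ar A)
    (φ : FOForm σ ar Empty) : Prop :=
  FOSat M Empty φ (fun e => e.elim)

/-- Quantifier-free first-order formulas. -/
def FOForm.isQF {σ : Type} {ar : σ → ℕ} : (V : Type) → FOForm σ ar V → Prop
  | _, .all _ => False
  | _, .ex _ => False
  | V, .not φ => FOForm.isQF V φ
  | V, .and φ ψ => FOForm.isQF V φ ∧ FOForm.isQF V ψ
  | V, .or φ ψ => FOForm.isQF V φ ∧ FOForm.isQF V ψ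
  | _, _ => True

/-- Universal first-order formulas: a block of `∀` followed by a quantifier-free formula. -/
inductive FOForm.IsUniversal {σ : Type} {ar : σ → ℕ} : {V : Type} → FOForm σ ar V → Prop
  | of_qf {V : Type} (φ : FOForm σ ar V) : FOForm.isQF V φ → FOForm.IsUniversal φ
  | all {V : Type} (φ : FOForm σ ar (Option V)) :
      FOForm.IsUniversal φ → FOForm.IsUniversal (.all φ)

/-- `OptIter l V` adds `l` fresh variables to the variable type `V`. -/
def OptIter : ℕ → Type → Type
  | 0, V => V
  | l+1, V => Option (OptIter l V)

/-- The embedding of the old variables into `OptIter l V`. -/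
def optEmbed : (l : ℕ) → {V : Type} → V → OptIter l V
  | 0, _, v => v
  | l+1, _, v => some (optEmbed l v)

/-- Prefix a first-order formula with `l` universal quantifiers. -/
def FOForm.allIter {σ : Type} {ar : σ → ℕ} :
    (l : ℕ) → {V : Type} → FOForm σ ar (OptIter l V) → FOForm σ ar V
  | 0, _, φ => φ
  | l+1, _, φ => FOForm.allIter l (.all φ)

/-- Prefix a dependence formula with `l` universal quantifiers. -/
def DepFormula.allIter {σ : Type} {ar : σ → ℕ} :
    (l : ℕ) → {V : Type} → DepFormula σ ar (OptIter l V) → DepFormula σ ar V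
  | 0, _, φ => φ
  | l+1, _, φ => DepFormula.allIter l (.all φ)

/-- The iterated duplicate team `T⟨y⃗ ↦ A⟩`: all extensions of members of `T`
to the `l` new variables. -/
def dupIter {A : Type} (l : ℕ) {V : Type} (T : Set (V → A)) : Set (OptIter l V → A) :=
  {s | (fun v => s (optEmbed l v)) ∈ T}

/-- The vocabulary `τ ∪ {R}` with `R` a fresh `n`-ary relation symbol. -/
def exAr {σ : Type} (ar : σ → ℕ) (n : ℕ) : σ ⊕ Unit → ℕ :=
  Sum.elim ar fun _ => n

/-- The expansion `(A, Rel(T))` of a structure by a team, interpreting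
the fresh symbol `R` as the `n`-ary relation determined by the team `T`. -/
def expandR {σ : Type} {ar : σ → ℕ} {A : Type} {n : ℕ}
    (M : DepStr σ ar A) (T : Set (Fin n → A)) : DepStr (σ ⊕ Unit) (exAr ar n) A :=
  ⟨fun r => match r with
    | .inl r => M.rel r
    | .inr _ => fun v => v ∈ T⟩

/-- `ψ` rewrites the dependence formula `φ(x₁,…,xₙ)`:  `A ⊨_T φ  ↔  (A, Rel(T)) ⊨ ψ`. -/
def Rewrites {σ : Type} {ar : σ → ℕ} {n : ℕ}
    (ψ : FOForm (σ ⊕ Unit) (exAr ar n) Empty) (φ : DepFormula σ ar (Fin n)) : Prop :=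
  ∀ (A : Type) [Nonempty A] (M : DepStr σ ar A) (T : Set (Fin n → A)),
    DepSat M (Fin n) φ T ↔ FOTrue (expandR M T) ψ

/-- `φ` is first-order rewritable. -/
def FORewritable {σ : Type} {ar : σ → ℕ} {n : ℕ} (φ : DepFormula σ ar (Fin n)) : Prop :=
  ∃ ψ : FOForm (σ ⊕ Unit) (exAr ar n) Empty, Rewrites ψ φ

/-- `φ` is rewritable to a universal first-order sentence. -/
def UnivRewritable {σ : Type} {ar : σ → ℕ} {n : ℕ} (φ : DepFormula σ ar (Fin n)) : Prop :=
  ∃ ψ : FOForm (σ ⊕ Unit) (exAr ar n) Empty, ψ.IsUniversal ∧ Rewrites ψ φ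

/-- `φ` is `k`-coherent: a team satisfies `φ` iff all its subteams with at
most `k` elements do. -/
def KCoherent {σ : Type} {ar : σ → ℕ} {V : Type} (k : ℕ) (φ : DepFormula σ ar V) : Prop :=
  ∀ (A : Type) [Nonempty A] (M : DepStr σ ar A) (T : Set (V → A)),
    DepSat M V φ T ↔ ∀ S ⊆ T, S.Finite → S.ncard ≤ k → DepSat M V φ S

/-- `φ` is coherent: `k`-coherent for some `k ≥ 1`. -/
def Coherent {σ : Type} {ar : σ → ℕ} {V : Type} (φ : DepFormula σ ar V) : Prop :=
  ∃ k : ℕ, 1 ≤ k ∧ KCoherent k φ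

/-- `φ` is `k`-coherent in the finite. -/
def KCoherentFin {σ : Type} {ar : σ → ℕ} {V : Type} (k : ℕ) (φ : DepFormula σ ar V) : Prop :=
  ∀ (A : Type) [Nonempty A] [Finite A] (M : DepStr σ ar A) (T : Set (V → A)),
    DepSat M V φ T ↔ ∀ S ⊆ T, S.Finite → S.ncard ≤ k → DepSat M V φ S

/-- Strong `k`-coherence of `∀y₁…∀y_l β` (with `β` quantifier-free): a team `T`
satisfies `∀y⃗ β` iff every at-most-`k`-element subteam of the duplicated team
`T⟨y⃗ ↦ A⟩` satisfies `β`. -/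
def StronglyKCoherent {σ : Type} {ar : σ → ℕ} (k : ℕ) (n l : ℕ)
    (β : DepFormula σ ar (OptIter l (Fin n))) : Prop :=
  ∀ (A : Type) [Nonempty A] (M : DepStr σ ar A) (T : Set (Fin n → A)),
    DepSat M (Fin n) (DepFormula.allIter l β) T ↔
      ∀ S ⊆ dupIter l T, S.Finite → S.ncard ≤ k → DepSat M (OptIter l (Fin n)) β S

/-- Strong `k`-coherence in the finite. -/
def StronglyKCoherentFin {σ : Type} {ar : σ → ℕ} (k : ℕ) (n l : ℕ)
    (β : DepFormula σ ar (OptIter l (Fin n))) : Prop :=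
  ∀ (A : Type) [Nonempty A] [Finite A] (M : DepStr σ ar A) (T : Set (Fin n → A)),
    DepSat M (Fin n) (DepFormula.allIter l β) T ↔
      ∀ S ⊆ dupIter l T, S.Finite → S.ncard ≤ k → DepSat M (OptIter l (Fin n)) β S

namespace Stmt8Aux

theorem depSat_allIter {σ : Type} {ar : σ → ℕ} {A : Type} (M : DepStr σ ar A) (l : ℕ) :
    ∀ {V : Type} (β : DepFormula σ ar (OptIter l V)) (T : Set (V → A)),
      DepSat M V (DepFormula.allIter l β) T ↔ DepSat M (OptIter l V) β (dupIter l T) := by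
  induction l with
  | zero => intro V β T; exact Iff.rfl
  | succ l ih => intro V β T; exact ih (.all β) T

theorem foSat_allIter {σ : Type} {ar : σ → ℕ} {A : Type} (M : DepStr σ ar A) (m : ℕ) :
    ∀ {V : Type} (θ : FOForm σ ar (OptIter m V)) (s : V → A),
      FOSat M V (FOForm.allIter m θ) s ↔
        ∀ t : OptIter m V → A, (∀ v, t (optEmbed m v) = s v) → FOSat M (OptIter m V) θ t := by
  induction m with
  | zero =>
    intro V θ s
    constructor
    · intro h t ht
      have : t = s := funext ht
      rw [this]; exact h
    · intro h; exact h s (fun _ => rfl)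
  | succ m ih =>
    intro V θ s
    refine (ih (.all θ) s).trans ?_
    constructor
    · intro h t ht
      have h1 := h (fun v => t (some v)) ht (t none)
      have : (fun o : Option (OptIter m V) => Option.elim o (t none) (fun v => t (some v))) = t := by
        funext o; cases o <;> rfl
      rw [this] at h1; exact h1
    · intro h t ht a
      exact h (fun o => Option.elim o a t) ht

theorem isUniversal_allIter {σ : Type} {ar : σ → ℕ} (m : ℕ) :
    ∀ {V : Type} (θ : FOForm σ ar (OptIter m V)), θ.IsUniversal →
      (FOForm.allIter m θ).IsUniversal := by
  induction m with
  | zero => intro V θ h; exact h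
  | succ m ih => intro V θ h; exact ih (.all θ) (.all θ h)

theorem optIter_finite (l : ℕ) (V : Type) [Finite V] : Finite (OptIter l V) := by
  induction l with
  | zero => assumption
  | succ l ih => exact (inferInstance : Finite (Option (OptIter l V)))

theorem optIter_card (l : ℕ) (V : Type) [Finite V] :
    Nat.card (OptIter l V) = Nat.card V + l := by
  induction l with
  | zero => rfl
  | succ l ih =>
    have := optIter_finite l V
    have : Nat.card (Option (OptIter l V)) = Nat.card (OptIter l V) + 1 := Finite.card_option
    show Nat.card (Option (OptIter l V)) = _
    omega

theorem depSat_mono {σ : Type} {ar : σ → ℕ} {A : Type} (M : DepStr σ ar A) {V : Type}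
    (β : DepFormula σ ar V) : DepFormula.isQF V β → ∀ {S T : Set (V → A)}, S ⊆ T →
      DepSat M V β T → DepSat M V β S := by
  induction β with
  | rel r ts => intro _ S T h hT s hs; exact hT s (h hs)
  | nrel r ts => intro _ S T h hT s hs; exact hT s (h hs)
  | eq x y => intro _ S T h hT s hs; exact hT s (h hs)
  | neq x y => intro _ S T h hT s hs; exact hT s (h hs)
  | dep m ys z => intro _ S T h hT s hs t ht; exact hT s (h hs) t (h ht)
  | and φ ψ ih1 ih2 => intro q S T h hT; exact ⟨ih1 q.1 h hT.1, ih2 q.2 h hT.2⟩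
  | or φ ψ ih1 ih2 =>
    rintro q S T h ⟨T₁, T₂, rfl, h1, h2⟩
    refine ⟨S ∩ T₁, S ∩ T₂, ?_, ih1 q.1 Set.inter_subset_right h1,
      ih2 q.2 Set.inter_subset_right h2⟩
    rw [← Set.inter_union_distrib_left]
    exact (Set.inter_eq_left.mpr h).symm
  | all φ ih => intro q; exact q.elim
  | ex φ ih => intro q; exact q.elim

theorem depSat_empty {σ : Type} {ar : σ → ℕ} {A : Type} (M : DepStr σ ar A) {V : Type}
    (β : DepFormula σ ar V) : DepFormula.isQF V β → DepSat M V β ∅ := by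
  induction β with
  | rel r ts => intro _ s hs; exact hs.elim
  | nrel r ts => intro _ s hs; exact hs.elim
  | eq x y => intro _ s hs; exact hs.elim
  | neq x y => intro _ s hs; exact hs.elim
  | dep m ys z => intro _ s hs; exact hs.elim
  | and φ ψ ih1 ih2 => intro q; exact ⟨ih1 q.1, ih2 q.2⟩
  | or φ ψ ih1 ih2 => intro q; exact ⟨∅, ∅, by simp, ih1 q.1, ih2 q.2⟩
  | all φ ih => intro q; exact q.elim
  | ex φ ih => intro q; exact q.elim

/-- Compactness of quantifier-free dependence formulas. -/
theorem depSat_compact {σ : Type} {ar : σ → ℕ} {A : Type} (M : DepStr σ ar A) {V : Type}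
    (β : DepFormula σ ar V) : DepFormula.isQF V β → ∀ {T : Set (V → A)},
      (∀ S ⊆ T, S.Finite → DepSat M V β S) → DepSat M V β T := by
  classical
  induction β with
  | rel r ts =>
    intro _ T h s hs; exact h {s} (by simpa using hs) (Set.finite_singleton s) s rfl
  | nrel r ts =>
    intro _ T h s hs; exact h {s} (by simpa using hs) (Set.finite_singleton s) s rfl
  | eq r ts =>
    intro _ T h s hs; exact h {s} (by simpa using hs) (Set.finite_singleton s) s rfl
  | neq r ts =>
    intro _ T h s hs; exact h {s} (by simpa using hs) (Set.finite_singleton s) s rfl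
  | dep m ys z =>
    intro _ T h s hs t ht
    exact h {s, t} (by rintro x (rfl | rfl) <;> assumption) (Set.toFinite _) s (Or.inl rfl)
      t (Or.inr rfl)
  | and φ ψ ih1 ih2 =>
    intro q T h
    exact ⟨ih1 q.1 fun S hS hf => (h S hS hf).1, ih2 q.2 fun S hS hf => (h S hS hf).2⟩
  | or φ ψ ih1 ih2 =>
    rename_i V
    intro q T h
    have h' : ∀ F : Finset T, ∃ T₁ T₂, (Subtype.val '' (F : Set T)) = T₁ ∪ T₂ ∧
        DepSat M V φ T₁ ∧ DepSat M V ψ T₂ := fun F =>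
      h _ (by rintro _ ⟨x, _, rfl⟩; exact x.2) (F.finite_toSet.image _)
    choose T₁ T₂ hU h1 h2 using h'
    let U : Ultrafilter (Finset T) := Ultrafilter.of Filter.atTop
    have hU' : (U : Filter (Finset T)) ≤ Filter.atTop := Ultrafilter.of_le _
    refine ⟨{t | t ∈ T ∧ ∀ᶠ F in (U : Filter (Finset T)), t ∈ T₁ F},
      {t | t ∈ T ∧ ∀ᶠ F in (U : Filter (Finset T)), t ∈ T₂ F}, ?_, ?_, ?_⟩
    · ext t
      constructor
      · intro ht
        have e : ∀ᶠ F in (U : Filter (Finset T)), t ∈ T₁ F ∨ t ∈ T₂ F := by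
          have : ∀ᶠ F in (Filter.atTop : Filter (Finset T)), ({⟨t, ht⟩} : Finset T) ≤ F :=
            Filter.eventually_ge_atTop _
          filter_upwards [hU' this] with F hF
          have : t ∈ T₁ F ∪ T₂ F := by
            rw [← hU]; exact ⟨⟨t, ht⟩, by simpa using hF, rfl⟩
          exact this
        rcases Ultrafilter.eventually_or.mp e with e | e
        · exact Or.inl ⟨ht, e⟩
        · exact Or.inr ⟨ht, e⟩
      · rintro (h | h) <;> exact h.1
    · apply ih1 q.1
      intro S hS hf
      have : ∀ᶠ F in (U : Filter (Finset T)), ∀ t ∈ S, t ∈ T₁ F :=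
        (Filter.eventually_all_finite hf).mpr fun t ht => (hS ht).2
      obtain ⟨F, hF⟩ := this.exists
      exact depSat_mono M φ q.1 hF (h1 F)
    · apply ih2 q.2
      intro S hS hf
      have : ∀ᶠ F in (U : Filter (Finset T)), ∀ t ∈ S, t ∈ T₂ F :=
        (Filter.eventually_all_finite hf).mpr fun t ht => (hS ht).2
      obtain ⟨F, hF⟩ := this.exists
      exact depSat_mono M ψ q.2 hF (h2 F)
  | all φ ih => intro q; exact q.elim
  | ex φ ih => intro q; exact q.elim

theorem depSat_sub {σ : Type} {ar : σ → ℕ} {A : Type} (M : DepStr σ ar A) (B : Set A) {V : Type}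
    (β : DepFormula σ ar V) : DepFormula.isQF V β → ∀ (S : Set (V → B)),
      (DepSat (M.sub B) V β S ↔ DepSat M V β ((fun (t : V → B) v => (t v : A)) '' S)) := by
  induction β with
  | rel r ts => intro _ S; simp only [DepSat, Set.forall_mem_image]; exact Iff.rfl
  | nrel r ts => intro _ S; simp only [DepSat, Set.forall_mem_image]; exact Iff.rfl
  | eq x y => intro _ S; simp only [DepSat, Set.forall_mem_image, Subtype.ext_iff]
  | neq x y => intro _ S; simp only [DepSat, Set.forall_mem_image, ne_eq, Subtype.ext_iff]
  | dep m ys z => intro _ S; simp only [DepSat, Set.forall_mem_image, Subtype.ext_iff]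
  | and φ ψ ih1 ih2 => intro q S; simp only [DepSat, ih1 q.1, ih2 q.2]
  | or φ ψ ih1 ih2 =>
    rename_i V
    intro q S
    constructor
    · rintro ⟨T₁, T₂, rfl, h1, h2⟩
      exact ⟨_, _, Set.image_union _ _ _, (ih1 q.1 _).mp h1, (ih2 q.2 _).mp h2⟩
    · rintro ⟨T₁, T₂, hT, h1, h2⟩
      have inj : Function.Injective (fun (t : V → B) v => (t v : A)) := by
        intro s t h; funext v; exact Subtype.ext (congrFun h v)
      refine ⟨(fun (t : V → B) v => (t v : A)) ⁻¹' T₁, (fun (t : V → B) v => (t v : A)) ⁻¹' T₂,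
        ?_, ?_, ?_⟩
      · rw [← Set.preimage_union, ← hT, Set.preimage_image_eq _ inj]
      · exact (ih1 q.1 _).mpr (depSat_mono M φ q.1 (Set.image_preimage_subset _ _) h1)
      · exact (ih2 q.2 _).mpr (depSat_mono M ψ q.2 (Set.image_preimage_subset _ _) h2)
  | all φ ih => intro q; exact q.elim
  | ex φ ih => intro q; exact q.elim

theorem foSat_sub {σ : Type} {ar : σ → ℕ} {A : Type} (M : DepStr σ ar A) (B : Set A) {V : Type}
    (θ : FOForm σ ar V) : FOForm.isQF V θ → ∀ (s : V → B),
      (FOSat (M.sub B) V θ s ↔ FOSat M V θ (fun v => (s v : A))) := by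
  induction θ with
  | rel r ts => intro _ s; exact Iff.rfl
  | eq x y => intro _ s; simp only [FOSat, Subtype.ext_iff]
  | not φ ih => intro q s; simp only [FOSat]; rw [ih q]
  | and φ ψ ih1 ih2 => intro q s; simp only [FOSat, ih1 q.1, ih2 q.2]
  | or φ ψ ih1 ih2 => intro q s; simp only [FOSat, ih1 q.1, ih2 q.2]
  | all φ ih => intro q; exact q.elim
  | ex φ ih => intro q; exact q.elim

/-- Failure of `φ` is witnessed by `m` elements, in every larger substructure. -/
def Wit {σ : Type} {ar : σ → ℕ} {V : Type} (φ : FOForm σ ar V) (m : ℕ) : Prop :=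
  ∀ (A : Type) (M : DepStr σ ar A) (s : V → A), ¬ FOSat M V φ s →
    ∃ B : Set A, B.Finite ∧ B.ncard ≤ m ∧ ∀ B' : Set A, B ⊆ B' → ∀ s' : V → B',
      (∀ v, (s' v : A) = s v) → ¬ FOSat (M.sub B') V φ s'

theorem wit_qf {σ : Type} {ar : σ → ℕ} {V : Type} (φ : FOForm σ ar V)
    (h : FOForm.isQF V φ) : Wit φ 0 := by
  intro A M s hs
  refine ⟨∅, Set.finite_empty, by simp, fun B' _ s' e h' => hs ?_⟩
  rw [foSat_sub M B' φ h] at h'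
  rwa [show (fun v => (s' v : A)) = s from funext e] at h'

theorem wit_all {σ : Type} {ar : σ → ℕ} {V : Type} (φ : FOForm σ ar (Option V)) (m : ℕ)
    (h : Wit φ m) : Wit (.all φ) (m + 1) := by
  intro A M s hs
  simp only [FOSat, not_forall] at hs
  obtain ⟨a, ha⟩ := hs
  obtain ⟨B, hf, hc, hB⟩ := h A M _ ha
  refine ⟨insert a B, hf.insert a, (Set.ncard_insert_le a B).trans (by omega), ?_⟩
  intro B' hB' s' e h'
  have haB : a ∈ B' := hB' (Set.mem_insert _ _)
  refine hB B' ((Set.subset_insert _ _).trans hB') _ ?_ (h' ⟨a, haB⟩)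
  intro o; cases o with
  | none => rfl
  | some v => exact e v

theorem wit_allIter {σ : Type} {ar : σ → ℕ} (m : ℕ) :
    ∀ {V : Type} (θ : FOForm σ ar (OptIter m V)) (j : ℕ), Wit θ j →
      Wit (FOForm.allIter m θ) (j + m) := by
  induction m with
  | zero => intro V θ j h; exact h
  | succ m ih =>
    intro V θ j h
    have := ih (.all θ) (j + 1) (wit_all θ j h)
    rw [show j + (m + 1) = j + 1 + m by omega]
    exact this

theorem wit_universal {σ : Type} {ar : σ → ℕ} {V : Type} (φ : FOForm σ ar V)
    (h : φ.IsUniversal) : ∃ m, Wit φ m := by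
  induction h with
  | of_qf φ h => exact ⟨0, wit_qf φ h⟩
  | all φ _ ih => obtain ⟨m, hm⟩ := ih; exact ⟨m + 1, wit_all φ m hm⟩

theorem expandR_sub {σ : Type} {ar : σ → ℕ} {A : Type} {n : ℕ} (M : DepStr σ ar A)
    (T : Set (Fin n → A)) (B : Set A) :
    (expandR M T).sub B = expandR (M.sub B) (teamRestrict T B) := by
  unfold DepStr.sub expandR
  congr 1
  funext r
  cases r <;> rfl

theorem strong_of_wit {σ : Type} {ar : σ → ℕ} {n l : ℕ}
    (β : DepFormula σ ar (OptIter l (Fin n)))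
    (hβ : DepFormula.isQF (OptIter l (Fin n)) β)
    (ψ : FOForm (σ ⊕ Unit) (exAr ar n) Empty) (m : ℕ) (hm : 1 ≤ m) (hw : Wit ψ m)
    (hψ : Rewrites ψ (DepFormula.allIter l β)) : StronglyKCoherent (m ^ (n + l)) n l β := by
  intro A hA M T
  constructor
  · intro h S hS _ _
    exact depSat_mono M β hβ hS ((depSat_allIter M l β T).mp h)
  · intro h
    by_contra hc
    rw [hψ A M T] at hc
    obtain ⟨B, hf, hcard, hB⟩ := hw A _ _ hc
    obtain ⟨B', hBB, hf', hcard', hne⟩ :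
        ∃ B' : Set A, B ⊆ B' ∧ B'.Finite ∧ B'.ncard ≤ m ∧ B'.Nonempty := by
      rcases B.eq_empty_or_nonempty with rfl | hne
      · exact ⟨{Classical.arbitrary A}, Set.empty_subset _, Set.finite_singleton _,
          by simpa using hm, Set.singleton_nonempty _⟩
      · exact ⟨B, subset_rfl, hf, hcard, hne⟩
    have : Nonempty B' := hne.to_subtype
    have : Finite B' := hf'
    have := optIter_finite l (Fin n)
    refine hB B' hBB (fun e => e.elim) (fun e => e.elim) ?_
    rw [expandR_sub]
    refine (hψ B' (M.sub B') (teamRestrict T B')).mp ?_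
    rw [depSat_allIter, depSat_sub M B' β hβ]
    apply h
    · rintro _ ⟨t, ht, rfl⟩
      exact ht
    · exact (Set.toFinite _).image _
    · refine (Set.ncard_image_le (Set.toFinite _)).trans ?_
      refine (Set.ncard_le_card _).trans ?_
      rw [Nat.card_fun, optIter_card, Nat.card_fin, Nat.card_coe_set_eq]
      exact Nat.pow_le_pow_left hcard' _

/-- Expressibility by a quantifier-free formula. -/
def QFDefinable {σ : Type} (ar : σ → ℕ) (W : Type)
    (P : ∀ A : Type, DepStr σ ar A → (W → A) → Prop) : Prop :=
  ∃ χ : FOForm σ ar W, FOForm.isQF W χ ∧ ∀ A M s, FOSat M W χ s ↔ P A M s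

section
variable {σ : Type} {ar : σ → ℕ} {W : Type}
  {P Q : ∀ A : Type, DepStr σ ar A → (W → A) → Prop}

theorem QFDefinable.not (h : QFDefinable ar W P) : QFDefinable ar W (fun A M s => ¬ P A M s) := by
  obtain ⟨χ, q, h⟩ := h
  exact ⟨.not χ, q, fun A M s => not_congr (h A M s)⟩

theorem QFDefinable.and (h : QFDefinable ar W P) (h' : QFDefinable ar W Q) :
    QFDefinable ar W (fun A M s => P A M s ∧ Q A M s) := by
  obtain ⟨χ, q, h⟩ := h
  obtain ⟨χ', q', h'⟩ := h'
  exact ⟨.and χ χ', ⟨q, q'⟩, fun A M s => and_congr (h A M s) (h' A M s)⟩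

theorem QFDefinable.or (h : QFDefinable ar W P) (h' : QFDefinable ar W Q) :
    QFDefinable ar W (fun A M s => P A M s ∨ Q A M s) := by
  obtain ⟨χ, q, h⟩ := h
  obtain ⟨χ', q', h'⟩ := h'
  exact ⟨.or χ χ', ⟨q, q'⟩, fun A M s => or_congr (h A M s) (h' A M s)⟩

theorem QFDefinable.congr (h : QFDefinable ar W P) (e : ∀ A M s, P A M s ↔ Q A M s) : QFDefinable ar W Q := by
  obtain ⟨χ, q, h⟩ := h
  exact ⟨χ, q, fun A M s => (h A M s).trans (e A M s)⟩

theorem QFDefinable.eq (x y : W) : QFDefinable ar W (fun _ _ s => s x = s y) :=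
  ⟨.eq x y, trivial, fun _ _ _ => Iff.rfl⟩

theorem QFDefinable.rel (r : σ) (ts : Fin (ar r) → W) :
    QFDefinable ar W (fun _ M s => M.rel r (fun i => s (ts i))) :=
  ⟨.rel r ts, trivial, fun _ _ _ => Iff.rfl⟩

theorem QFDefinable.tru [Nonempty W] : QFDefinable ar W (fun _ _ _ => True) :=
  (QFDefinable.eq (Classical.arbitrary W) (Classical.arbitrary W)).congr (by simp)

theorem QFDefinable.ball [Nonempty W] {ι : Type*} (I : Finset ι)
    (P : ι → ∀ A : Type, DepStr σ ar A → (W → A) → Prop) (h : ∀ i, QFDefinable ar W (P i)) :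
    QFDefinable ar W (fun A M s => ∀ i ∈ I, P i A M s) := by
  classical
  induction I using Finset.induction_on with
  | empty => exact QFDefinable.tru.congr (by simp)
  | insert a I _ ih => exact ((h a).and ih).congr (by simp)

theorem QFDefinable.bex [Nonempty W] {ι : Type*} (I : Finset ι)
    (P : ι → ∀ A : Type, DepStr σ ar A → (W → A) → Prop) (h : ∀ i, QFDefinable ar W (P i)) :
    QFDefinable ar W (fun A M s => ∃ i ∈ I, P i A M s) :=
  (QFDefinable.ball I _ (fun i => (h i).not)).not.congr (by simp)

theorem QFDefinable.all [Nonempty W] {ι : Type*} [Finite ι]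
    (P : ι → ∀ A : Type, DepStr σ ar A → (W → A) → Prop) (h : ∀ i, QFDefinable ar W (P i)) :
    QFDefinable ar W (fun A M s => ∀ i, P i A M s) := by
  haveI := Fintype.ofFinite ι
  exact (QFDefinable.ball Finset.univ P h).congr (by simp)
end

/-- Reduct of an expanded structure. -/
def red {σ : Type} {ar : σ → ℕ} {A : Type} {n : ℕ}
    (N : DepStr (σ ⊕ Unit) (exAr ar n) A) : DepStr σ ar A := ⟨fun r => N.rel (.inl r)⟩

/-- The team coded by an assignment. -/
def codeTeam {ι V W A : Type} (e : ι → V → W) (I : Finset ι) (s : W → A) : Set (V → A) :=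
  (fun i v => s (e i v)) '' (I : Set ι)

theorem expr_team {σ : Type} {ar : σ → ℕ} {n : ℕ} {W ι : Type} [Nonempty W] {V : Type}
    (β : DepFormula σ ar V) : DepFormula.isQF V β → ∀ (e : ι → V → W) (I : Finset ι),
    QFDefinable (exAr ar n) W (fun _ N s => DepSat (red N) V β (codeTeam e I s)) := by
  classical
  induction β with
  | rel r ts =>
    intro _ e I
    refine (QFDefinable.ball I _ fun i => QFDefinable.rel (ar := exAr ar n) (.inl r)
      (fun j => e i (ts j))).congr ?_
    intro A M s
    simp only [DepSat, codeTeam, Set.forall_mem_image]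
    exact Iff.rfl
  | nrel r ts =>
    intro _ e I
    refine (QFDefinable.ball I _ fun i => (QFDefinable.rel (ar := exAr ar n) (.inl r)
      (fun j => e i (ts j))).not).congr ?_
    intro A M s
    simp only [DepSat, codeTeam, Set.forall_mem_image]
    exact Iff.rfl
  | eq x y =>
    intro _ e I
    refine (QFDefinable.ball I _ fun i => QFDefinable.eq (e i x) (e i y)).congr ?_
    intro A M s
    simp only [DepSat, codeTeam, Set.forall_mem_image]
    exact Iff.rfl
  | neq x y =>
    intro _ e I
    refine (QFDefinable.ball I _ fun i => (QFDefinable.eq (e i x) (e i y)).not).congr ?_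
    intro A M s
    simp only [DepSat, codeTeam, Set.forall_mem_image]
    exact Iff.rfl
  | dep m ys z =>
    intro _ e I
    refine (QFDefinable.ball I _ fun i => QFDefinable.ball I _ fun j =>
      (QFDefinable.all _ fun a => QFDefinable.eq (e i (ys a)) (e j (ys a))).not.or
        (QFDefinable.eq (e i z) (e j z))).congr ?_
    intro A M s
    simp only [DepSat, codeTeam, Set.forall_mem_image, ← imp_iff_not_or]
    exact Iff.rfl
  | and φ ψ ih1 ih2 =>
    intro q e I
    exact (ih1 q.1 e I).and (ih2 q.2 e I)
  | or φ ψ ih1 ih2 =>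
    intro q e I
    refine (QFDefinable.bex ((I.powerset ×ˢ I.powerset).filter (fun p => p.1 ∪ p.2 = I)) _ fun p =>
      (ih1 q.1 e p.1).and (ih2 q.2 e p.2)).congr ?_
    intro A M s
    constructor
    · rintro ⟨⟨J, K⟩, hp, h1, h2⟩
      have hJK : J ∪ K = I := (Finset.mem_filter.mp hp).2
      refine ⟨_, _, ?_, h1, h2⟩
      subst hJK
      simp only [codeTeam, Finset.coe_union, Set.image_union]
    · rintro ⟨T₁, T₂, hT, h1, h2⟩
      have key : ∀ T' : Set _, T' ⊆ codeTeam e I s →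
          codeTeam e (I.filter fun i => (fun v => s (e i v)) ∈ T') s = T' := by
        intro T' hT'
        ext t
        constructor
        · rintro ⟨i, hi, rfl⟩
          exact (Finset.mem_filter.mp hi).2
        · intro ht
          obtain ⟨i, hi, rfl⟩ := hT' ht
          exact ⟨i, Finset.mem_filter.mpr ⟨hi, ht⟩, rfl⟩
      refine ⟨⟨I.filter fun i => (fun v => s (e i v)) ∈ T₁,
        I.filter fun i => (fun v => s (e i v)) ∈ T₂⟩, ?_, ?_, ?_⟩
      · refine Finset.mem_filter.mpr ⟨by simp, ?_⟩
        rw [← Finset.filter_or, Finset.filter_eq_self]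
        intro i hi
        have : (fun v => s (e i v)) ∈ T₁ ∪ T₂ := by rw [← hT]; exact ⟨i, hi, rfl⟩
        exact this
      · dsimp only
        rw [key T₁ (by rw [hT]; exact Set.subset_union_left)]; exact h1
      · dsimp only
        rw [key T₂ (by rw [hT]; exact Set.subset_union_right)]; exact h2
  | all φ ih => intro q; exact q.elim
  | ex φ ih => intro q; exact q.elim

theorem univ_of_strong {σ : Type} {ar : σ → ℕ} {n l : ℕ}
    (β : DepFormula σ ar (OptIter l (Fin n)))
    (hβ : DepFormula.isQF (OptIter l (Fin n)) β) (k : ℕ) (hk : 1 ≤ k)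
    (h : StronglyKCoherent k n l β) : UnivRewritable (DepFormula.allIter l β) := by
  have := optIter_finite l (Fin n)
  let X := Option (Fin k × OptIter l (Fin n))
  let m := Nat.card X
  have := optIter_finite m Empty
  have ec : Nat.card X = Nat.card (OptIter m Empty) := by
    rw [optIter_card]; simp [m]
  let E : X ≃ OptIter m Empty := (Finite.equivFin X).trans ((finCongr ec).trans (Finite.equivFin _).symm)
  have : Nonempty (OptIter m Empty) := ⟨E none⟩
  let e : Fin k → OptIter l (Fin n) → OptIter m Empty := fun i v => E (some (i, v))
  obtain ⟨χ, hq, hχ⟩ := (QFDefinable.all _ fun i : Fin k => QFDefinable.rel (ar := exAr ar n) (.inr ())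
    (fun j : Fin n => e i (optEmbed l j))).not.or (expr_team (n := n) β hβ e Finset.univ)
  refine ⟨FOForm.allIter m χ, isUniversal_allIter m χ (.of_qf χ hq), ?_⟩
  intro A hA M T
  rw [h A M T]
  unfold FOTrue
  rw [foSat_allIter]
  constructor
  · intro hS t _
    refine (hχ _ _ _).mpr (imp_iff_not_or.mp ?_)
    intro ht
    refine hS _ ?_ ?_ ?_
    · rintro _ ⟨i, _, rfl⟩
      exact ht i
    · exact (Finset.finite_toSet _).image _
    · refine (Set.ncard_image_le (Finset.finite_toSet _)).trans ?_
      simp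
  · intro hF S hS hf hc
    rcases S.eq_empty_or_nonempty with rfl | hne
    · exact depSat_empty M β hβ
    · obtain ⟨f, hfr⟩ : ∃ f : Fin k → (OptIter l (Fin n) → A), Set.range f = S := by
        have : Finite S := hf
        have : Nonempty S := hne.to_subtype
        haveI := Fintype.ofFinite S
        have : Nat.card S ≤ Nat.card (Fin k) := by simpa [Nat.card_coe_set_eq] using hc
        obtain ⟨g⟩ : Nonempty (S ↪ Fin k) := by
          apply Function.Embedding.nonempty_of_card_le
          simpa [Nat.card_eq_fintype_card] using this
        refine ⟨fun i => (Function.invFun g i : S), ?_⟩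
        ext x
        constructor
        · rintro ⟨i, rfl⟩; exact (Function.invFun g i).2
        · intro hx
          exact ⟨g ⟨x, hx⟩, by simp [Function.leftInverse_invFun g.injective ⟨x, hx⟩]⟩
      let t : OptIter m Empty → A := fun w =>
        Option.elim (E.symm w) (Classical.arbitrary A) (fun p => f p.1 p.2)
      have hte : ∀ i v, t (e i v) = f i v := by intro i v; simp [t, e]
      have := imp_iff_not_or.mpr ((hχ _ _ _).mp (hF t (fun v => v.elim)))
      have h2 := this (by
        intro i
        have : f i ∈ dupIter l T := hS (hfr ▸ Set.mem_range_self i)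
        have h3 : (fun v => f i (optEmbed l v)) ∈ T := this
        show (fun j => t (e i (optEmbed l j))) ∈ T
        simpa only [hte] using h3)
      have h4 : codeTeam e Finset.univ t = S := by
        simp only [codeTeam, hte, Finset.coe_univ, Set.image_univ]
        exact hfr
      rw [h4] at h2
      exact h2

section Ultra
variable {σ : Type} {ar : σ → ℕ} (U : Ultrafilter ℕ) {A : ℕ → Type}

/-- Carrier of the ultraproduct. -/
abbrev Up (A : ℕ → Type) : Type := (U : Filter ℕ).Product A

/-- The ultraproduct structure. -/
noncomputable def upStr (M : ∀ i, DepStr σ ar (A i)) : DepStr σ ar (Up U A) :=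
  ⟨fun r v => ∀ᶠ i in (U : Filter ℕ), (M i).rel r (fun j => (v j).out i)⟩

theorem out_mk (a : ∀ i, A i) : ∀ᶠ i in (U : Filter ℕ),
    (Quotient.mk ((U : Filter ℕ).productSetoid A) a).out i = a i :=
  Quotient.mk_out (s := (U : Filter ℕ).productSetoid A) a

theorem los [∀ i, Nonempty (A i)] (M : ∀ i, DepStr σ ar (A i)) {V : Type} (φ : FOForm σ ar V) :
    ∀ s : V → Up U A, FOSat (upStr U M) V φ s ↔
      ∀ᶠ i in (U : Filter ℕ), FOSat (M i) V φ (fun v => (s v).out i) := by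
  have helim : ∀ {V : Type} (s : V → Up U A) (a : Up U A) (i : ℕ),
      (fun o : Option V => (Option.elim o a s).out i) =
        fun o : Option V => Option.elim o (a.out i) (fun v => (s v).out i) := by
    intro V s a i; funext o; cases o <;> rfl
  induction φ with
  | rel r ts => intro s; exact Iff.rfl
  | eq x y =>
    intro s
    show s x = s y ↔ ∀ᶠ i in (U : Filter ℕ), (s x).out i = (s y).out i
    exact Quotient.out_equiv_out.symm
  | not φ ih =>
    intro s
    show ¬ _ ↔ ∀ᶠ i in (U : Filter ℕ), ¬ _
    rw [Ultrafilter.eventually_not, ih]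
  | and φ ψ ih1 ih2 =>
    intro s
    show _ ∧ _ ↔ ∀ᶠ i in (U : Filter ℕ), _ ∧ _
    rw [Filter.eventually_and, ih1, ih2]
  | or φ ψ ih1 ih2 =>
    intro s
    show _ ∨ _ ↔ ∀ᶠ i in (U : Filter ℕ), _ ∨ _
    rw [Ultrafilter.eventually_or, ih1, ih2]
  | all φ ih =>
    intro s
    simp only [FOSat, ih, helim]
    constructor
    · intro h
      by_contra hc
      rw [← Ultrafilter.eventually_not] at hc
      simp only [not_forall] at hc
      have : ∀ i, ∃ a : A i, (∃ a, ¬ FOSat (M i) _ φ fun o => o.elim a fun v => (s v).out i) →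
          ¬ FOSat (M i) _ φ fun o => o.elim a fun v => (s v).out i := by
        intro i
        by_cases hi : ∃ a, ¬ FOSat (M i) _ φ fun o => o.elim a fun v => (s v).out i
        · obtain ⟨a, ha⟩ := hi; exact ⟨a, fun _ => ha⟩
        · exact ⟨Classical.arbitrary _, fun h => (hi h).elim⟩
      choose a ha using this
      have h1 := h (Quotient.mk ((U : Filter ℕ).productSetoid A) a)
      obtain ⟨i, h1, h2, h3⟩ := (h1.and (hc.and (out_mk U a))).exists
      rw [h3] at h1
      exact ha i h2 h1
    · intro h a
      filter_upwards [h] with i hi using hi _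
  | ex φ ih =>
    intro s
    simp only [FOSat, ih, helim]
    constructor
    · rintro ⟨a, ha⟩
      filter_upwards [ha] with i hi using ⟨_, hi⟩
    · intro h
      have : ∀ i, ∃ a : A i, (∃ a, FOSat (M i) _ φ fun o => o.elim a fun v => (s v).out i) →
          FOSat (M i) _ φ fun o => o.elim a fun v => (s v).out i := by
        intro i
        by_cases hi : ∃ a, FOSat (M i) _ φ fun o => o.elim a fun v => (s v).out i
        · obtain ⟨a, ha⟩ := hi; exact ⟨a, fun _ => ha⟩
        · exact ⟨Classical.arbitrary _, fun h => (hi h).elim⟩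
      choose a ha using this
      refine ⟨Quotient.mk ((U : Filter ℕ).productSetoid A) a, ?_⟩
      filter_upwards [h, out_mk U a] with i hi h3
      rw [h3]
      exact ha i hi
end Ultra

theorem strong_of_fo {σ : Type} {ar : σ → ℕ} {n l : ℕ}
    (β : DepFormula σ ar (OptIter l (Fin n)))
    (hβ : DepFormula.isQF (OptIter l (Fin n)) β)
    (h : FORewritable (DepFormula.allIter l β)) :
    ∃ k : ℕ, 1 ≤ k ∧ StronglyKCoherent k n l β := by
  classical
  obtain ⟨ψ, hψ⟩ := h
  by_contra hc
  have hk : ∀ k : ℕ, ∃ (A : Type) (_ : Nonempty A) (M : DepStr σ ar A) (T : Set (Fin n → A)),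
      ¬ DepSat M (Fin n) (DepFormula.allIter l β) T ∧
      ∀ S ⊆ dupIter l T, S.Finite → S.ncard ≤ k + 1 → DepSat M (OptIter l (Fin n)) β S := by
    intro k
    by_contra hn
    refine hc ⟨k + 1, by omega, fun A hA M T => ⟨?_, ?_⟩⟩
    · intro h S hS _ _
      exact depSat_mono M β hβ hS ((depSat_allIter M l β T).mp h)
    · intro hS
      by_contra h'
      exact hn ⟨A, hA, M, T, h', hS⟩
  choose A hA M T hT hS using hk
  let U : Ultrafilter ℕ := Filter.hyperfilter ℕ
  let N := upStr U (fun i => expandR (M i) (T i))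
  let T' : Set (Fin n → Up U A) := {v | N.rel (.inr ()) v}
  have hN : expandR (red N) T' = N := by
    have : ∀ N' : DepStr (σ ⊕ Unit) (exAr ar n) (Up U A),
        expandR (red N') {v | N'.rel (.inr ()) v} = N' := by
      rintro ⟨rel⟩
      unfold expandR red
      congr 1
      funext r
      rcases r with r | ⟨⟩ <;> rfl
    exact this N
  have : Nonempty (Up U A) := ⟨Quotient.mk _ (fun i => Classical.arbitrary (A i))⟩
  have h1 : ¬ DepSat (red N) (Fin n) (DepFormula.allIter l β) T' := by
    rw [hψ, hN]
    unfold FOTrue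
    rw [los]
    intro he
    obtain ⟨i, hi⟩ := he.exists
    refine hT i ((hψ (A i) (M i) (T i)).mpr ?_)
    unfold FOTrue
    convert hi
  apply h1
  rw [depSat_allIter]
  apply depSat_compact _ β hβ
  intro S hST hf
  let ι := OptIter l (Fin n) → Up U A
  let W := Option (ι × OptIter l (Fin n))
  let e : ι → OptIter l (Fin n) → W := fun i v => some (i, v)
  let I : Finset ι := hf.toFinset
  obtain ⟨χ, _, hχ⟩ := expr_team (n := n) β hβ e I
  let s : W → Up U A := fun o => Option.elim o (Classical.arbitrary _) (fun p => p.1 p.2)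
  have hS' : codeTeam e I s = S := by
    simp [codeTeam, e, s, I]
  rw [← hS']
  refine (hχ _ _ _).mp ((los U _ χ s).mpr ?_)
  have hmem : ∀ᶠ k in (U : Filter ℕ), ∀ t ∈ S,
      (fun v => (t (optEmbed l v)).out k) ∈ T k :=
    (Filter.eventually_all_finite hf).mpr fun t ht => hST ht
  have hge : ∀ᶠ k in (U : Filter ℕ), I.card ≤ k :=
    Nat.hyperfilter_le_atTop (Filter.eventually_ge_atTop _)
  filter_upwards [hmem, hge] with k h2 h3
  refine (hχ _ _ _).mpr ?_
  refine hS k _ ?_ ?_ ?_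
  · rintro _ ⟨t, ht, rfl⟩
    exact h2 t (by simpa [I] using ht)
  · exact (Finset.finite_toSet _).image _
  · refine (Set.ncard_image_le (Finset.finite_toSet _)).trans ?_
    rw [Set.ncard_coe_finset]; omega

end Stmt8Aux

/-- For `φ(z₁,…,zₙ) = ∀y₁…∀y_l β` with `β` quantifier-free, the
following are equivalent: (1) `φ` is strongly coherent; (2) `φ` is rewritable to a
universal first-order sentence; (3) `φ` is first-order rewritable. Moreover, if the
rewriting sentence is (equivalent to) a universal first-order sentence with `m`
universal quantifiers, then `φ` is strongly `m^(n+l)`-coherent. -/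
theorem stmt8 {σ : Type} {ar : σ → ℕ} {n l : ℕ}
    (β : DepFormula σ ar (OptIter l (Fin n)))
    (hβ : DepFormula.isQF (OptIter l (Fin n)) β) :
    ((∃ k : ℕ, 1 ≤ k ∧ StronglyKCoherent k n l β) ↔
        UnivRewritable (DepFormula.allIter l β)) ∧
    (UnivRewritable (DepFormula.allIter l β) ↔ FORewritable (DepFormula.allIter l β)) ∧
    (∀ m : ℕ, 1 ≤ m →
      ∀ θ : FOForm (σ ⊕ Unit) (exAr ar n) (OptIter m Empty),
        FOForm.isQF (OptIter m Empty) θ →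
        Rewrites (FOForm.allIter m θ) (DepFormula.allIter l β) →
        StronglyKCoherent (m ^ (n + l)) n l β) := by
  refine ⟨⟨?_, ?_⟩, ⟨?_, ?_⟩, ?_⟩
  · rintro ⟨k, hk, h⟩
    exact Stmt8Aux.univ_of_strong β hβ k hk h
  · rintro ⟨ψ, _, hr⟩
    exact Stmt8Aux.strong_of_fo β hβ ⟨ψ, hr⟩
  · rintro ⟨ψ, _, hr⟩
    exact ⟨ψ, hr⟩
  · intro h
    obtain ⟨k, hk, h⟩ := Stmt8Aux.strong_of_fo β hβ h
    exact Stmt8Aux.univ_of_strong β hβ k hk h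
  · intro m hm θ hθ hr
    refine Stmt8Aux.strong_of_wit β hβ _ m hm ?_ hr
    have := Stmt8Aux.wit_allIter m θ 0 (Stmt8Aux.wit_qf θ hθ)
    rwa [Nat.zero_add] at this
end

section
/- Let φ be a ∀D(τ)-formula of the form ∀y₁…∀y_l θ with θ quantifier-free, and let k ≥ 1. Then φ is strongly k-coherent if and only if φ is strongly k-coherent in the finite. -/
theorem depSat_allIter {σ : Type} {ar : σ → ℕ} {A : Type} (M : DepStr σ ar A) (l : ℕ) {V : Type}
    (β : DepFormula σ ar (OptIter l V)) (T : Set (V → A)) :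
    DepSat M V (DepFormula.allIter l β) T ↔ DepSat M (OptIter l V) β (dupIter l T) := by
  induction l with
  | zero => exact Iff.rfl
  | succ l ih =>
    have h := ih (.all β)
    have h2 : DepSat M (OptIter l V) (.all β) (dupIter l T) ↔
        DepSat M (Option (OptIter l V)) β {s | (fun v => s (some v)) ∈ dupIter l T} := by
      conv_lhs => unfold DepSat
    exact h.trans h2

theorem depSat_mono {σ : Type} {ar : σ → ℕ} {A : Type} (M : DepStr σ ar A) {V : Type}
    (β : DepFormula σ ar V) (hβ : DepFormula.isQF V β) :
    ∀ S T : Set (V → A), S ⊆ T → DepSat M V β T → DepSat M V β S := by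
  induction β with
  | rel r ts => intro S T h; simp only [DepSat]; exact fun H s hs => H s (h hs)
  | nrel r ts => intro S T h; simp only [DepSat]; exact fun H s hs => H s (h hs)
  | eq x y => intro S T h; simp only [DepSat]; exact fun H s hs => H s (h hs)
  | neq x y => intro S T h; simp only [DepSat]; exact fun H s hs => H s (h hs)
  | dep m ys z =>
    intro S T h; simp only [DepSat]; exact fun H s hs t ht => H s (h hs) t (h ht)
  | and φ ψ ih1 ih2 =>
    simp only [DepFormula.isQF] at hβ
    intro S T h; simp only [DepSat]
    exact fun H => ⟨ih1 hβ.1 S T h H.1, ih2 hβ.2 S T h H.2⟩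
  | or φ ψ ih1 ih2 =>
    simp only [DepFormula.isQF] at hβ
    intro S T h; simp only [DepSat]
    rintro ⟨P, Q, rfl, hP, hQ⟩
    refine ⟨S ∩ P, S ∩ Q, ?_, ih1 hβ.1 _ P Set.inter_subset_right hP,
      ih2 hβ.2 _ Q Set.inter_subset_right hQ⟩
    rw [← Set.inter_union_distrib_left, Set.inter_eq_left.2 h]
  | all φ ih => simp only [DepFormula.isQF] at hβ
  | ex φ ih => simp only [DepFormula.isQF] at hβ

/-- Satisfaction of quantifier-free formulas passes to ultralimits of teams. -/
theorem depSat_ultra {σ : Type} {ar : σ → ℕ} {A I : Type} (U : Ultrafilter I)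
    (M : DepStr σ ar A) {V : Type}
    (β : DepFormula σ ar V) (hβ : DepFormula.isQF V β) :
    ∀ S : I → Set (V → A), (∀ i, DepSat M V β (S i)) →
      DepSat M V β {s | ∀ᶠ i in (U : Filter I), s ∈ S i} := by
  induction β with
  | rel r ts =>
    intro S; simp only [DepSat]; intro h s hs
    obtain ⟨i, hi⟩ := Filter.Eventually.exists hs
    exact h i s hi
  | nrel r ts =>
    intro S; simp only [DepSat]; intro h s hs
    obtain ⟨i, hi⟩ := Filter.Eventually.exists hs
    exact h i s hi
  | eq x y =>
    intro S; simp only [DepSat]; intro h s hs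
    obtain ⟨i, hi⟩ := Filter.Eventually.exists hs
    exact h i s hi
  | neq x y =>
    intro S; simp only [DepSat]; intro h s hs
    obtain ⟨i, hi⟩ := Filter.Eventually.exists hs
    exact h i s hi
  | dep m ys z =>
    intro S; simp only [DepSat]; intro h s hs t ht
    obtain ⟨i, hi, hi2⟩ := Filter.Eventually.exists (Filter.Eventually.and hs ht)
    exact h i s hi t hi2
  | and φ ψ ih1 ih2 =>
    simp only [DepFormula.isQF] at hβ
    intro S; simp only [DepSat]
    exact fun H => ⟨ih1 hβ.1 S fun i => (H i).1, ih2 hβ.2 S fun i => (H i).2⟩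
  | or φ ψ ih1 ih2 =>
    simp only [DepFormula.isQF] at hβ
    intro S; simp only [DepSat]
    intro H
    choose P Q hS hP hQ using H
    refine ⟨_, _, ?_, ih1 hβ.1 P hP, ih2 hβ.2 Q hQ⟩
    ext s
    simp only [Set.mem_ofPred_eq, Set.mem_union, hS, Ultrafilter.eventually_or]
  | all φ ih => simp only [DepFormula.isQF] at hβ
  | ex φ ih => simp only [DepFormula.isQF] at hβ

theorem depSat_compact {σ : Type} {ar : σ → ℕ} {A : Type}
    (M : DepStr σ ar A) {V : Type}
    (β : DepFormula σ ar V) (hβ : DepFormula.isQF V β) (T : Set (V → A))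
    (h : ∀ S ⊆ T, S.Finite → DepSat M V β S) : DepSat M V β T := by
  classical
  let U : Ultrafilter (Finset (V → A)) := Ultrafilter.of Filter.atTop
  have hU : (U : Filter (Finset (V → A))) ≤ Filter.atTop := Ultrafilter.of_le _
  have key := depSat_ultra U M β hβ (fun F => (F : Set (V → A)) ∩ T)
    (fun F => h _ Set.inter_subset_right (F.finite_toSet.inter_of_left T))
  refine depSat_mono M β hβ _ _ ?_ key
  intro s hs
  have h1 : ∀ᶠ F : Finset (V → A) in Filter.atTop, s ∈ (F : Set (V → A)) ∩ T := by
    filter_upwards [Filter.eventually_ge_atTop ({s} : Finset (V → A))] with F hF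
    exact ⟨hF (Finset.mem_singleton_self s), hs⟩
  exact hU h1

theorem depSat_sub {σ : Type} {ar : σ → ℕ} {A : Type} (M : DepStr σ ar A) (B : Set A) {V : Type}
    (β : DepFormula σ ar V) (hβ : DepFormula.isQF V β) :
    ∀ S : Set (V → B), DepSat (M.sub B) V β S ↔
      DepSat M V β ((fun (s : V → B) v => (s v : A)) '' S) := by
  induction β with
  | rel r ts => intro S; simp only [DepSat, Set.forall_mem_image]; exact Iff.rfl
  | nrel r ts => intro S; simp only [DepSat, Set.forall_mem_image]; exact Iff.rfl
  | eq x y => intro S; simp only [DepSat, Set.forall_mem_image, Subtype.ext_iff]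
  | neq x y => intro S; simp only [DepSat, Set.forall_mem_image, ne_eq, Subtype.ext_iff]
  | dep m ys z => intro S; simp only [DepSat, Set.forall_mem_image, Subtype.ext_iff]
  | and φ ψ ih1 ih2 =>
    simp only [DepFormula.isQF] at hβ
    intro S; simp only [DepSat, ih1 hβ.1, ih2 hβ.2]
  | @or V φ ψ ih1 ih2 =>
    simp only [DepFormula.isQF] at hβ
    intro S; simp only [DepSat, ih1 hβ.1, ih2 hβ.2]
    have inj : Function.Injective (fun (s : V → B) v => (s v : A)) := by
      intro s t hst
      funext v
      exact Subtype.ext (congrFun hst v)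
    constructor
    · rintro ⟨P, Q, rfl, hP, hQ⟩
      exact ⟨_, _, Set.image_union _ _ _, hP, hQ⟩
    · rintro ⟨P, Q, hS, hP, hQ⟩
      obtain ⟨P', -, rfl⟩ := Set.subset_image_iff.1 (hS ▸ Set.subset_union_left : P ⊆ _ '' S)
      obtain ⟨Q', -, rfl⟩ := Set.subset_image_iff.1 (hS ▸ Set.subset_union_right : Q ⊆ _ '' S)
      refine ⟨P', Q', ?_, hP, hQ⟩
      rw [← Set.image_union] at hS
      exact inj.image_injective hS
  | all φ ih => simp only [DepFormula.isQF] at hβ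
  | ex φ ih => simp only [DepFormula.isQF] at hβ

theorem optIter_finite (l : ℕ) (V : Type) [Finite V] : Finite (OptIter l V) := by
  induction l with
  | zero => assumption
  | succ l ih => exact inferInstanceAs (Finite (Option (OptIter l V)))

/-- For `φ = ∀y₁…∀y_l θ` with `θ` quantifier-free and `k ≥ 1`:
`φ` is strongly `k`-coherent iff `φ` is strongly `k`-coherent in the finite. -/
theorem stmt9 {σ : Type} {ar : σ → ℕ} {n l : ℕ}
    (β : DepFormula σ ar (OptIter l (Fin n)))
    (hβ : DepFormula.isQF (OptIter l (Fin n)) β) (k : ℕ) (hk : 1 ≤ k) :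
    StronglyKCoherent k n l β ↔ StronglyKCoherentFin k n l β := by
  refine ⟨fun h A _ _ M T => h A M T, fun h A _ M T => ?_⟩
  rw [depSat_allIter]
  refine ⟨fun H S hS _ _ => depSat_mono M β hβ S _ hS H, fun H => ?_⟩
  refine depSat_compact M β hβ _ fun S₀ hS₀ hfin => ?_
  have := optIter_finite l (Fin n)
  obtain ⟨a⟩ := ‹Nonempty A›
  let B : Set A := insert a (⋃ s ∈ S₀, Set.range s)
  have hB : B.Finite := (hfin.biUnion fun s _ => Set.finite_range s).insert a
  have : Finite B := hB
  have : Nonempty B := ⟨⟨a, Set.mem_insert _ _⟩⟩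
  have hdup : DepSat (M.sub B) _ β (dupIter l (teamRestrict T B)) := by
    rw [← depSat_allIter, h B (M.sub B) (teamRestrict T B)]
    intro S hS hSf hSk
    rw [depSat_sub M B β hβ]
    refine H _ ?_ (hSf.image _) ((Set.ncard_image_le hSf).trans hSk)
    rintro _ ⟨s, hs, rfl⟩
    exact hS hs
  rw [depSat_sub M B β hβ] at hdup
  refine depSat_mono M β hβ _ _ ?_ hdup
  intro s hs
  have hv : ∀ v, s v ∈ B := fun v =>
    Set.mem_insert_of_mem _ (Set.mem_biUnion hs (Set.mem_range_self v))
  exact ⟨fun v => ⟨s v, hv v⟩, hS₀ hs, rfl⟩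
end

section
/- Let φ be the dependence logic formula ∃z(dep(z) ∧ ¬ z=x) over the empty vocabulary, where dep(z) is the constancy atom. For every nonempty set A, viewing A as a structure over the empty vocabulary and taking T to be the team of all assignments s : {x} → A, it holds that A ⊭_T φ, yet A ⊨_S φ for every proper subteam S ⊊ T. Consequently, φ is not λ-coherent for any cardinal λ. -/
/-- `λ`-coherence for a cardinal `λ`: a team satisfies `φ` iff all its subteams of
cardinality `< λ` do. -/
def LambdaCoherent {σ : Type} {ar : σ → ℕ} {V : Type} (lam : Cardinal)
    (φ : DepFormula σ ar V) : Prop :=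
  ∀ (A : Type) [Nonempty A] (M : DepStr σ ar A) (T : Set (V → A)),
    DepSat M V φ T ↔ ∀ Y ⊆ T, Cardinal.mk Y < lam → DepSat M V φ Y

/-- The formula `∃z (dep(z) ∧ ¬ z = x)` over the empty vocabulary, with the single
free variable `x`. -/
def phi11 : DepFormula Empty (fun e => e.elim) Unit :=
  .ex (.and (.dep 0 (fun i => i.elim0) none) (.neq none (some ())))

/-- For every nonempty `A` and the team `T` of all assignments
`{x} → A`, the formula `∃z (dep(z) ∧ ¬ z = x)` fails on `T`, yet holds on every
proper subteam of `T`.  Consequently it is not `λ`-coherent for any cardinal `λ`. -/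
theorem stmt11 :
    (∀ (A : Type) [Nonempty A] (M : DepStr Empty (fun e => e.elim) A),
      ¬ DepSat M Unit phi11 (Set.univ : Set (Unit → A)) ∧
      ∀ S : Set (Unit → A), S ⊂ Set.univ → DepSat M Unit phi11 S) ∧
    (∀ lam : Cardinal, ¬ LambdaCoherent lam phi11) := by
  have key : ∀ (A : Type) [Nonempty A] (M : DepStr Empty (fun e => e.elim) A),
      ¬ DepSat M Unit phi11 (Set.univ : Set (Unit → A)) ∧
      ∀ S : Set (Unit → A), S ⊂ Set.univ → DepSat M Unit phi11 S := by
    intro A _ M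
    constructor
    · intro h
      simp only [phi11, DepSat] at h
      obtain ⟨f, hdep, hne⟩ := h
      obtain ⟨a⟩ := ‹Nonempty A›
      let t : Unit → A := fun _ => a
      let u : Unit → A := fun _ => f t
      have h1 := hdep (fun o => Option.elim o (f t) t) ⟨t, trivial, rfl⟩
        (fun o => Option.elim o (f u) u) ⟨u, trivial, rfl⟩ (fun i => i.elim0)
      exact hne (fun o => Option.elim o (f u) u) ⟨u, trivial, rfl⟩ h1.symm
    · intro S hS
      obtain ⟨t, -, ht⟩ := Set.exists_of_ssubset hS
      simp only [phi11, DepSat]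
      refine ⟨fun _ => t (), ?_, ?_⟩
      · rintro _ ⟨u, _, rfl⟩ _ ⟨v, _, rfl⟩ _
        rfl
      · rintro _ ⟨u, hu, rfl⟩ h
        apply ht
        have : t = u := funext fun _ => h
        rwa [this]
  refine ⟨key, fun lam hl => ?_⟩
  let M : DepStr Empty (fun e => e.elim) (Option lam.out) := ⟨fun e => e.elim⟩
  obtain ⟨h1, h2⟩ := key (Option lam.out) M
  refine h1 ((hl _ M Set.univ).2 fun Y _ hY => h2 Y ?_)
  refine Set.ssubset_univ_iff.2 ?_
  rintro rfl
  refine absurd hY (not_lt.2 ?_)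
  simp
end

section
/- Fix k ≥ 2 and a relational vocabulary τ. Let θ be the first-order sentence ∀x₁…∀x_{k+1} ⋁_{1≤i<j≤k+1} x_i = x_j, and for a first-order sentence φ over τ let ψ be the D(τ)-formula (θ ∨ φ) ∨ ⋁_{i=1}^{k} dep(x), a formula with single free variable x, where dep(x) is the constancy atom. Then φ is true in every finite τ-structure of cardinality greater than k if and only if ψ is k-coherent in the finite. -/
/-- The `i`-th of the `l` fresh variables in `OptIter l V`. -/
def newVar : (l : ℕ) → {V : Type} → Fin l → OptIter l V
  | 0, _, i => i.elim0
  | l+1, V, i =>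
      Fin.lastCases (motive := fun _ => OptIter (l+1) V)
        (none : Option (OptIter l V))
        (fun j => (some (newVar l j) : Option (OptIter l V))) i

/-- Disjunction of a nonempty list of formulas (with a default for the empty list). -/
def orListD {σ : Type} {ar : σ → ℕ} {V : Type} (default : DepFormula σ ar V) :
    List (DepFormula σ ar V) → DepFormula σ ar V
  | [] => default
  | [ψ] => ψ
  | ψ :: l => .or ψ (orListD default l)

/-- Renaming of variables in a dependence formula. -/
def DepFormula.rename {σ : Type} {ar : σ → ℕ} :
    {V W : Type} → (V → W) → DepFormula σ ar V → DepFormula σ ar W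
  | _, _, f, .rel r ts => .rel r fun i => f (ts i)
  | _, _, f, .nrel r ts => .nrel r fun i => f (ts i)
  | _, _, f, .eq x y => .eq (f x) (f y)
  | _, _, f, .neq x y => .neq (f x) (f y)
  | _, _, f, .dep m ys z => .dep m (fun i => f (ys i)) (f z)
  | _, _, f, .and φ ψ => .and (DepFormula.rename f φ) (DepFormula.rename f ψ)
  | _, _, f, .or φ ψ => .or (DepFormula.rename f φ) (DepFormula.rename f ψ)
  | _, _, f, .all φ => .all (DepFormula.rename (Option.map f) φ)
  | _, _, f, .ex φ => .ex (DepFormula.rename (Option.map f) φ)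

/-- A dependence-logic sentence is true in `M`: it is satisfied by the team
consisting of the empty assignment. -/
def DTrueIn {σ : Type} {ar : σ → ℕ} {A : Type} (M : DepStr σ ar A)
    (φ : DepFormula σ ar Empty) : Prop :=
  DepSat M Empty φ {fun e => e.elim}

/-- The first-order sentence `∀x₁…∀x_{k+1} ⋁_{1 ≤ i < j ≤ k+1} xᵢ = xⱼ`
("there are at most `k` elements"), written as a dependence formula with the
single free variable `x` (not occurring in it). -/
def atMostK {σ : Type} (ar : σ → ℕ) (k : ℕ) : DepFormula σ ar (Fin 1) :=
  DepFormula.allIter (k+1)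
    (orListD (.eq (optEmbed (k+1) (0 : Fin 1)) (optEmbed (k+1) (0 : Fin 1)))
      ((((List.finRange (k+1)).product (List.finRange (k+1))).filter
          (fun p => p.1 < p.2)).map
        (fun p => .eq (newVar (k+1) p.1) (newVar (k+1) p.2))))

/-- The constancy atom `dep(x)`. -/
def depx {σ : Type} (ar : σ → ℕ) : DepFormula σ ar (Fin 1) :=
  .dep 0 (fun i => i.elim0) (0 : Fin 1)

/-- The disjunction `⋁_{i=1}^{k} dep(x)` of `k` copies of the constancy atom. -/
def depxOr {σ : Type} (ar : σ → ℕ) (k : ℕ) : DepFormula σ ar (Fin 1) :=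
  orListD (depx ar) (List.replicate k (depx ar))

/-- The formula `ψ = (θ ∨ φ) ∨ ⋁_{i=1}^{k} dep(x)`. -/
def psi12 {σ : Type} (ar : σ → ℕ) (k : ℕ) (φ : DepFormula σ ar Empty) :
    DepFormula σ ar (Fin 1) :=
  .or (.or (atMostK ar k) (φ.rename (fun e => e.elim))) (depxOr ar k)

/-- Tarskian satisfaction for (dependence-free) formulas. -/
def PSat {σ : Type} {ar : σ → ℕ} {A : Type} (M : DepStr σ ar A) :
    (V : Type) → DepFormula σ ar V → (V → A) → Prop
  | _, .rel r ts, s => M.rel r fun i => s (ts i)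
  | _, .nrel r ts, s => ¬ M.rel r fun i => s (ts i)
  | _, .eq x y, s => s x = s y
  | _, .neq x y, s => s x ≠ s y
  | _, .dep _ _ _, _ => True
  | V, .and φ ψ, s => PSat M V φ s ∧ PSat M V ψ s
  | V, .or φ ψ, s => PSat M V φ s ∨ PSat M V ψ s
  | V, .all φ, s => ∀ a : A, PSat M (Option V) φ (fun o => Option.elim o a s)
  | V, .ex φ, s => ∃ a : A, PSat M (Option V) φ (fun o => Option.elim o a s)

theorem flat {σ : Type} {ar : σ → ℕ} {A : Type} [Nonempty A] (M : DepStr σ ar A)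
    {V : Type} (φ : DepFormula σ ar V) (h : DepFormula.noDep V φ) (T : Set (V → A)) :
    DepSat M V φ T ↔ ∀ s ∈ T, PSat M V φ s := by
  induction φ with
  | rel r ts => rfl
  | nrel r ts => rfl
  | eq x y => rfl
  | neq x y => rfl
  | dep m ys z => exact h.elim
  | and φ ψ ih1 ih2 =>
    simp only [DepSat, PSat, ih1 h.1, ih2 h.2]
    grind
  | or φ ψ ih1 ih2 =>
    simp only [DepSat, PSat, ih1 h.1, ih2 h.2]
    constructor
    · rintro ⟨T1, T2, rfl, h1, h2⟩ s (hs | hs)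
      · exact Or.inl (h1 s hs)
      · exact Or.inr (h2 s hs)
    · intro h
      refine ⟨{s | s ∈ T ∧ PSat M _ φ s}, {s | s ∈ T ∧ PSat M _ ψ s}, ?_, fun s hs => hs.2,
        fun s hs => hs.2⟩
      ext s
      constructor
      · intro hs
        rcases h s hs with h1 | h1
        · exact Or.inl ⟨hs, h1⟩
        · exact Or.inr ⟨hs, h1⟩
      · rintro (hs | hs) <;> exact hs.1
  | all φ ih =>
    simp only [DepSat, PSat, ih h]
    constructor
    · intro h s hs a
      exact h _ hs
    · intro h s hs
      have := h _ hs (s none)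
      convert this using 1
      funext o
      cases o <;> rfl
  | ex φ ih =>
    simp only [DepSat, PSat, ih h]
    constructor
    · rintro ⟨f, hf⟩ s hs
      exact ⟨f s, hf _ ⟨s, hs, rfl⟩⟩
    · intro h
      classical
      refine ⟨fun s => if hs : s ∈ T then (h s hs).choose else Classical.arbitrary A, ?_⟩
      rintro s ⟨t, ht, rfl⟩
      have := (h t ht).choose_spec
      simpa only [dif_pos ht] using this

theorem psat_rename {σ : Type} {ar : σ → ℕ} {A : Type} (M : DepStr σ ar A)
    {V : Type} (φ : DepFormula σ ar V) :
    ∀ {W : Type} (f : V → W) (s : W → A),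
      PSat M W (φ.rename f) s ↔ PSat M V φ (fun v => s (f v)) := by
  have key : ∀ {V W : Type} (f : V → W) (s : W → A) (a : A),
      (fun v : Option V => (fun o : Option W => Option.elim o a s) (Option.map f v))
        = fun o => Option.elim o a (fun v => s (f v)) := by
    intro V W f s a
    funext o
    cases o <;> rfl
  induction φ with
  | rel r ts => intros; rfl
  | nrel r ts => intros; rfl
  | eq x y => intros; rfl
  | neq x y => intros; rfl
  | dep m ys z => intros; rfl
  | and φ ψ ih1 ih2 => intros; simp only [DepFormula.rename, PSat, ih1, ih2]
  | or φ ψ ih1 ih2 => intros; simp only [DepFormula.rename, PSat, ih1, ih2]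
  | all φ ih => intros; simp only [DepFormula.rename, PSat, ih, key]
  | ex φ ih => intros; simp only [DepFormula.rename, PSat, ih, key]

theorem noDep_rename {σ : Type} {ar : σ → ℕ} {V : Type} (φ : DepFormula σ ar V) :
    ∀ {W : Type} (f : V → W), DepFormula.noDep V φ → DepFormula.noDep W (φ.rename f) := by
  induction φ with
  | rel r ts => intros; trivial
  | nrel r ts => intros; trivial
  | eq x y => intros; trivial
  | neq x y => intros; trivial
  | dep m ys z => intro _ _ h; exact h.elim
  | and φ ψ ih1 ih2 => intro _ f h; exact ⟨ih1 f h.1, ih2 f h.2⟩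
  | or φ ψ ih1 ih2 => intro _ f h; exact ⟨ih1 f h.1, ih2 f h.2⟩
  | all φ ih => intro _ f h; exact ih _ h
  | ex φ ih => intro _ f h; exact ih _ h

theorem noDep_allIter {σ : Type} {ar : σ → ℕ} (l : ℕ) : ∀ {V : Type}
    (φ : DepFormula σ ar (OptIter l V)), DepFormula.noDep _ φ →
      DepFormula.noDep V (DepFormula.allIter l φ) := by
  induction l with
  | zero => intro V φ h; exact h
  | succ l ih => intro V φ h; exact ih (.all φ) h

theorem noDep_orListD {σ : Type} {ar : σ → ℕ} {V : Type} (d : DepFormula σ ar V)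
    (hd : DepFormula.noDep V d) (L : List (DepFormula σ ar V))
    (hL : ∀ ψ ∈ L, DepFormula.noDep V ψ) : DepFormula.noDep V (orListD d L) := by
  induction L with
  | nil => exact hd
  | cons ψ L ih =>
    cases L with
    | nil => exact hL ψ (by simp)
    | cons χ L =>
      exact ⟨hL ψ (by simp), ih (fun x hx => hL x (List.mem_cons_of_mem _ hx))⟩

theorem psat_orListD {σ : Type} {ar : σ → ℕ} {A : Type} (M : DepStr σ ar A) {V : Type}
    (d : DepFormula σ ar V) (s : V → A) (L : List (DepFormula σ ar V)) (hne : L ≠ []) :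
    PSat M V (orListD d L) s ↔ ∃ ψ ∈ L, PSat M V ψ s := by
  induction L with
  | nil => exact (hne rfl).elim
  | cons ψ L ih =>
    cases L with
    | nil => simp [orListD]
    | cons χ L =>
      have := ih (by simp)
      rw [List.exists_mem_cons_iff, ← this]
      rfl

theorem psat_allIter {σ : Type} {ar : σ → ℕ} {A : Type} (M : DepStr σ ar A) (l : ℕ) :
    ∀ {V : Type} (φ : DepFormula σ ar (OptIter l V)) (s : V → A),
    PSat M V (DepFormula.allIter l φ) s ↔
      ∀ s' : OptIter l V → A, (∀ v, s' (optEmbed l v) = s v) → PSat M _ φ s' := by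
  induction l with
  | zero =>
    intro V φ s
    constructor
    · intro h s' hs
      have : s' = s := funext hs
      rw [this]; exact h
    · intro h; exact h s (fun _ => rfl)
  | succ l ih =>
    intro V φ s
    refine (ih (.all φ) s).trans ?_
    constructor
    · intro h s' hs
      have := h (fun v => s' (some v)) hs (s' none)
      have e : (fun o : Option (OptIter l V) => Option.elim o (s' none) fun v => s' (some v))
          = s' := by
        funext o
        cases o <;> rfl
      rw [e] at this
      exact this
    · intro h s' hs a
      exact h (fun o => Option.elim o a s') hs

theorem exists_ext {A : Type} (l : ℕ) : ∀ {V : Type} (s : V → A) (g : Fin l → A),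
    ∃ s' : OptIter l V → A, (∀ v, s' (optEmbed l v) = s v) ∧ ∀ i, s' (newVar l i) = g i := by
  induction l with
  | zero => intro V s g; exact ⟨s, fun _ => rfl, fun i => i.elim0⟩
  | succ l ih =>
    intro V s g
    obtain ⟨s', h1, h2⟩ := ih s (fun i => g i.castSucc)
    refine ⟨fun o => Option.elim o (g (Fin.last l)) s', h1, fun i => ?_⟩
    refine Fin.lastCases ?_ (fun j => ?_) i
    · have e : newVar (l+1) (V := V) (Fin.last l) = (none : Option (OptIter l V)) :=
        Fin.lastCases_last (motive := fun _ => OptIter (l+1) V)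
      rw [e]
      rfl
    · have e : newVar (l+1) (V := V) j.castSucc = (some (newVar l j) : Option (OptIter l V)) :=
        Fin.lastCases_castSucc (motive := fun _ => OptIter (l+1) V) j
      rw [e]
      exact h2 j

theorem noDep_atMostK {σ : Type} (ar : σ → ℕ) (k : ℕ) :
    DepFormula.noDep _ (atMostK ar k) := by
  apply noDep_allIter
  apply noDep_orListD
  · trivial
  · intro ψ hψ
    obtain ⟨p, _, rfl⟩ := List.mem_map.1 hψ
    trivial

theorem psat_atMostK {σ : Type} {ar : σ → ℕ} {A : Type} [Finite A] (M : DepStr σ ar A) (k : ℕ)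
    (hk : 2 ≤ k) (s : Fin 1 → A) : PSat M _ (atMostK ar k) s ↔ Nat.card A ≤ k := by
  have hmem : ∀ p : Fin (k+1) × Fin (k+1),
      p ∈ ((List.finRange (k+1)).product (List.finRange (k+1))).filter (fun p => p.1 < p.2)
        ↔ p.1 < p.2 := by
    rintro ⟨a, b⟩
    simp [List.mem_filter, List.pair_mem_product]
  have hne : ((((List.finRange (k+1)).product (List.finRange (k+1))).filter
          (fun p => p.1 < p.2)).map
        (fun p => (.eq (newVar (k+1) p.1) (newVar (k+1) p.2) :
          DepFormula σ ar (OptIter (k+1) (Fin 1))))) ≠ [] := by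
    intro h
    have h := List.map_eq_nil_iff.1 h
    have := (hmem (⟨0, by omega⟩, ⟨1, by omega⟩)).2 (Nat.zero_lt_one)
    rw [h] at this
    simp at this
  unfold atMostK
  rw [psat_allIter]
  simp only [psat_orListD M _ _ _ hne, List.mem_map]
  constructor
  · intro h
    by_contra hc
    have : Fintype A := Fintype.ofFinite A
    obtain ⟨g⟩ : Nonempty (Fin (k+1) ↪ A) := by
      apply Function.Embedding.nonempty_of_card_le
      rw [Nat.card_eq_fintype_card] at hc
      simp; omega
    obtain ⟨s', h1, h2⟩ := exists_ext (k+1) s g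
    obtain ⟨_, ⟨p, hp, rfl⟩, hs⟩ := h s' h1
    have hs : s' (newVar (k+1) p.1) = s' (newVar (k+1) p.2) := hs
    rw [h2, h2] at hs
    have := g.injective hs
    have hp := (hmem p).1 hp
    rw [this] at hp
    exact lt_irrefl _ hp
  · intro h s' _
    have : Fintype A := Fintype.ofFinite A
    obtain ⟨a, b, hab, he⟩ := Fintype.exists_ne_map_eq_of_card_lt
      (fun i : Fin (k+1) => s' (newVar (k+1) i))
      (by rw [Nat.card_eq_fintype_card] at h; simp; omega)
    rcases lt_or_gt_of_ne hab with hlt | hlt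
    · exact ⟨_, ⟨(a, b), (hmem _).2 hlt, rfl⟩, he⟩
    · exact ⟨_, ⟨(b, a), (hmem _).2 hlt, rfl⟩, he.symm⟩

theorem sat_depx {σ : Type} {ar : σ → ℕ} {A : Type} (M : DepStr σ ar A)
    (T : Set (Fin 1 → A)) : DepSat M _ (depx ar) T ↔ T.Subsingleton := by
  constructor
  · intro h s hs t ht
    have := h s hs t ht (fun i => i.elim0)
    funext i
    rw [Subsingleton.elim i 0]
    exact this
  · intro h s hs t ht _
    rw [h hs ht]

theorem sat_depxOr {σ : Type} {ar : σ → ℕ} {A : Type} [Finite A] (M : DepStr σ ar A) (k : ℕ) :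
    ∀ T : Set (Fin 1 → A), DepSat M _ (depxOr ar (k+1)) T ↔ T.ncard ≤ k+1 := by
  induction k with
  | zero =>
    intro T
    refine (sat_depx M T).trans ?_
    rw [zero_add, Set.ncard_le_one_iff_subsingleton]
  | succ k ih =>
    intro T
    have e : DepSat M _ (depxOr ar (k+1+1)) T ↔ ∃ T₁ T₂, T = T₁ ∪ T₂ ∧
        DepSat M _ (depx ar) T₁ ∧ DepSat M _ (depxOr ar (k+1)) T₂ := Iff.rfl
    rw [e]
    simp only [ih, sat_depx]
    constructor
    · rintro ⟨T1, T2, rfl, h1, h2⟩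
      have := Set.ncard_union_le T1 T2
      have := Set.ncard_le_one_iff_subsingleton.2 h1
      omega
    · intro h
      rcases T.eq_empty_or_nonempty with rfl | ⟨s, hs⟩
      · exact ⟨∅, ∅, by simp, by simp, by simp⟩
      · refine ⟨{s}, T \ {s}, ?_, by simp, ?_⟩
        · rw [Set.union_sdiff_cancel (by simpa using hs)]
        · rw [Set.ncard_sdiff_singleton_of_mem hs]; omega

/-- Fix `k ≥ 2` and a relational vocabulary `τ`. A first-order
sentence `φ` (a dependence-logic sentence without dependence atoms) is true in every
finite `τ`-structure of cardinality `> k` iff `ψ = (θ ∨ φ) ∨ ⋁_{i=1}^{k} dep(x)` is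
`k`-coherent in the finite, where `θ = ∀x₁…∀x_{k+1} ⋁_{i<j} xᵢ = xⱼ`. -/
theorem stmt13 {σ : Type} {ar : σ → ℕ} (k : ℕ) (hk : 2 ≤ k)
    (φ : DepFormula σ ar Empty) (hφ : DepFormula.noDep Empty φ) :
    (∀ (A : Type) [Finite A] (M : DepStr σ ar A),
        (k : Cardinal) < Cardinal.mk A → DTrueIn M φ) ↔
      KCoherentFin k (psi12 ar k φ) := by
  obtain ⟨k, rfl⟩ : ∃ m, k = m + 1 := ⟨k - 1, by omega⟩
  have hcard : ∀ (A : Type) [Finite A],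
      ((k+1 : ℕ) : Cardinal) < Cardinal.mk A ↔ k+1 < Nat.card A := by
    intro A _
    rw [← Nat.cast_card, Nat.cast_lt]
  have hren : ∀ (A : Type) [Nonempty A] (M : DepStr σ ar A) (s : Fin 1 → A),
      PSat M _ (φ.rename (fun e => e.elim)) s ↔ DTrueIn M φ := by
    intro A _ M s
    rw [psat_rename, DTrueIn, flat M φ hφ]
    simp only [Set.mem_singleton_iff, forall_eq]
    rw [Subsingleton.elim (fun v : Empty => s v.elim) (fun e => e.elim)]
  have hnd := noDep_rename φ (fun e => e.elim : Empty → Fin 1) hφ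
  have hpsi : ∀ (A : Type) [Nonempty A] [Finite A] (M : DepStr σ ar A) (T : Set (Fin 1 → A)),
      DepSat M _ (psi12 ar (k+1) φ) T ↔
        (Nat.card A ≤ k+1 ∨ DTrueIn M φ) ∨ T.ncard ≤ k+1 := by
    intro A _ _ M T
    have e : DepSat M _ (psi12 ar (k+1) φ) T ↔ ∃ T₁ T₂, T = T₁ ∪ T₂ ∧
        DepSat M _ (.or (atMostK ar (k+1)) (φ.rename (fun e => e.elim))) T₁ ∧
        DepSat M _ (depxOr ar (k+1)) T₂ := Iff.rfl
    rw [e]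
    simp only [sat_depxOr]
    have e2 : ∀ T₁, DepSat M _ (.or (atMostK ar (k+1)) (φ.rename (fun e => e.elim))) T₁ ↔
        ∀ s ∈ T₁, (Nat.card A ≤ k+1 ∨ DTrueIn M φ) := by
      intro T₁
      have hnd' : DepFormula.noDep _ (.or (atMostK ar (k+1)) (φ.rename (fun e => e.elim))) :=
        ⟨noDep_atMostK ar (k+1), hnd⟩
      rw [flat M _ hnd']
      simp only [PSat, hren, psat_atMostK M (k+1) hk]
    simp only [e2]
    constructor
    · rintro ⟨T1, T2, rfl, h1, h2⟩
      rcases T1.eq_empty_or_nonempty with rfl | ⟨s, hs⟩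
      · right; simpa using h2
      · left; exact h1 s hs
    · rintro (h | h)
      · exact ⟨T, ∅, by simp, fun _ _ => h, by simp⟩
      · exact ⟨∅, T, by simp, by simp, h⟩
  constructor
  · intro h A _ _ M T
    have hA : Nat.card A ≤ k+1 ∨ DTrueIn M φ := by
      by_cases hc : Nat.card A ≤ k+1
      · exact Or.inl hc
      · exact Or.inr (h A M ((hcard A).2 (by omega)))
    simp only [hpsi]
    exact ⟨fun _ _ _ _ _ => Or.inl hA, fun _ => Or.inl hA⟩
  · intro h A _ M hA
    rw [hcard] at hA
    have : Nonempty A := (Nat.card_pos_iff.1 (by omega : 0 < Nat.card A)).1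
    have h1 := (h A M Set.univ).2 (fun S _ _ hS => (hpsi A M S).2 (Or.inr hS))
    rw [hpsi, Set.ncard_univ, Nat.card_fun] at h1
    simp only [Nat.card_eq_fintype_card (α := Fin 1), Fintype.card_fin, pow_one] at h1
    rcases h1 with (h1 | h1) | h1
    · omega
    · exact h1
    · omega
end
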